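/- Local two-sided bounds for convolutions of powers of Bessel kernels: Let d ≥ 1, a ∈ (0,d), r ∈ [1, d/(d−a)), and set α := d − r(d−a) ∈ (0, d). Then there exist constants 0 < c ≤ C, depending only on d, a, r, such that for all x ∈ ℝ^d with 0 < |x| < 1: (1) if α > d/2 then c ≤ (G_a^r ∗ G_a^r)(x) ≤ C; (2) if α < d/2 then c |x|^{2α−d} ≤ (G_a^r ∗ G_a^r)(x) ≤ C |x|^{2α−d}; (3) if α = d/2 then c · log(1/|x|) ≤ (G_a^r ∗ G_a^r)(x) ≤ C (1 + log(1/|x|)). -/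

import Mathlib

open MeasureTheory Set
open scoped ENNReal

/-- The Bessel-type kernel `G_a(x) = ∫_0^∞ (4πt)^{-d/2} e^{-|x|²/(4t)} e^{-t} t^{a/2-1} dt`. -/
noncomputable def besselKer (d : ℕ) (a : ℝ) (x : EuclideanSpace ℝ (Fin d)) : ℝ :=
  ∫ t in Ioi (0 : ℝ),
    (4 * Real.pi * t) ^ (-(d : ℝ) / 2) * Real.exp (-‖x‖ ^ 2 / (4 * t)) *
      Real.exp (-t) * t ^ (a / 2 - 1)

/-- The convolution `(G_a^r ∗ G_a^r)(x)`, valued in `[0,∞]`. -/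
noncomputable def besselConv (d : ℕ) (a r : ℝ) (x : EuclideanSpace ℝ (Fin d)) : ℝ≥0∞ :=
  ∫⁻ y, ENNReal.ofReal (besselKer d a (x - y) ^ r * besselKer d a y ^ r)

lemma integrableOn_rpow_mul_exp_neg_div {p b : ℝ} (hp : 0 < p) (hb : 0 < b) :
    IntegrableOn (fun t : ℝ => t ^ (-p - 1) * Real.exp (-b / t)) (Ioi 0) := by
  have h := integrableOn_rpow_mul_exp_neg_mul_rpow (p := 1) (s := p - 1) (b := b)
    (by linarith) one_pos hb
  rw [← integrableOn_Ioi_comp_rpow_iff' _ (p := -1) (by norm_num)] at h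
  refine h.congr_fun (fun t (ht : 0 < t) => ?_) measurableSet_Ioi
  simp only [smul_eq_mul, Real.rpow_one, Real.rpow_neg_one]
  rw [← mul_assoc, Real.inv_rpow ht.le, ← Real.rpow_neg ht.le, ← Real.rpow_add ht]
  congr 2
  ring

lemma integral_rpow_mul_exp_neg_div {p b : ℝ} (hp : 0 < p) (hb : 0 < b) :
    ∫ t in Ioi (0 : ℝ), t ^ (-p - 1) * Real.exp (-b / t) = b ^ (-p) * Real.Gamma p := by
  have h := Real.integral_rpow_mul_exp_neg_mul_Ioi hp hb
  rw [← integral_comp_rpow_Ioi _ (p := -1) (by norm_num)] at h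
  rw [one_div, Real.inv_rpow hb.le, ← Real.rpow_neg hb.le] at h
  rw [← h]
  refine setIntegral_congr_fun measurableSet_Ioi (fun t (ht : 0 < t) => ?_)
  simp only [smul_eq_mul, Real.rpow_neg_one, abs_neg, abs_one, one_mul]
  rw [← mul_assoc, Real.inv_rpow ht.le, ← Real.rpow_neg ht.le, ← Real.rpow_add ht]
  congr 2 <;> ring

lemma besselKer_eq (d : ℕ) (a : ℝ) (x : EuclideanSpace ℝ (Fin d)) :
    besselKer d a x = (4 * Real.pi) ^ (-(d : ℝ) / 2) * ∫ t in Ioi (0 : ℝ),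
      t ^ (-((d - a) / 2) - 1) * Real.exp (-(‖x‖ ^ 2 / 4) / t) * Real.exp (-t) := by
  rw [besselKer, ← integral_const_mul]
  refine setIntegral_congr_fun measurableSet_Ioi (fun t (ht : 0 < t) => ?_)
  rw [Real.mul_rpow (by positivity) ht.le,
    show -(((d : ℝ) - a) / 2) - 1 = -(d : ℝ) / 2 + (a / 2 - 1) by ring, Real.rpow_add ht,
    show -‖x‖ ^ 2 / (4 * t) = -(‖x‖ ^ 2 / 4) / t by field_simp]
  ring

lemma besselKer_nonneg (d : ℕ) (a : ℝ) (x : EuclideanSpace ℝ (Fin d)) :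
    0 ≤ besselKer d a x :=
  setIntegral_nonneg measurableSet_Ioi fun t (ht : 0 < t) => by positivity

lemma besselKer_le_rpow {d : ℕ} {a : ℝ} (had : a < d) :
    ∃ C : ℝ, 0 < C ∧ ∀ x : EuclideanSpace ℝ (Fin d), x ≠ 0 →
      besselKer d a x ≤ C * ‖x‖ ^ (-((d : ℝ) - a)) := by
  have hp : 0 < ((d : ℝ) - a) / 2 := by linarith
  have hG := Real.Gamma_pos_of_pos hp
  refine ⟨(4 * Real.pi) ^ (-(d : ℝ) / 2) *
    ((4 : ℝ) ^ (((d : ℝ) - a) / 2) * Real.Gamma (((d : ℝ) - a) / 2)), by positivity,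
    fun x hx => ?_⟩
  have hx' : 0 < ‖x‖ := norm_pos_iff.2 hx
  have hb : 0 < ‖x‖ ^ 2 / 4 := by positivity
  rw [besselKer_eq, mul_assoc]
  gcongr
  calc _ ≤ ∫ t in Ioi (0 : ℝ), t ^ (-(((d : ℝ) - a) / 2) - 1) * Real.exp (-(‖x‖ ^ 2 / 4) / t) := by
        refine integral_mono_of_nonneg ?_ (integrableOn_rpow_mul_exp_neg_div hp hb) ?_
        · filter_upwards [ae_restrict_mem measurableSet_Ioi] with t (ht : 0 < t)
          simp only [Pi.zero_apply]
          positivity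
        · filter_upwards [ae_restrict_mem measurableSet_Ioi] with t (ht : 0 < t)
          exact mul_le_of_le_one_right (by positivity) (by simpa using ht.le)
    _ = _ := by
        rw [integral_rpow_mul_exp_neg_div hp hb, Real.div_rpow (by positivity) (by norm_num),
          ← Real.rpow_natCast, ← Real.rpow_mul hx'.le, Real.rpow_neg (by norm_num : (0 : ℝ) ≤ 4),
          div_inv_eq_mul, show ((2 : ℕ) : ℝ) * -(((d : ℝ) - a) / 2) = -((d : ℝ) - a) by
            push_cast; ring]
        ring

lemma besselKer_le_rpow_neg_two_mul {d : ℕ} (hd : 1 ≤ d) {a : ℝ} (ha0 : 0 < a) :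
    ∃ C : ℝ, 0 < C ∧ ∀ x : EuclideanSpace ℝ (Fin d), x ≠ 0 →
      besselKer d a x ≤ C * ‖x‖ ^ (-(2 * (d : ℝ))) := by
  have hd' : (1 : ℝ) ≤ d := by exact_mod_cast hd
  have hq : 0 < (d : ℝ) - (d - a) / 2 := by linarith
  have hG := Real.Gamma_pos_of_pos hq
  refine ⟨(4 * Real.pi) ^ (-(d : ℝ) / 2) * ((4 : ℝ) ^ d * d.factorial *
    Real.Gamma ((d : ℝ) - (d - a) / 2)), by positivity, fun x hx => ?_⟩
  have hx' : 0 < ‖x‖ := norm_pos_iff.2 hx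
  have hb : 0 < ‖x‖ ^ 2 / 4 := by positivity
  rw [besselKer_eq, mul_assoc]
  gcongr
  calc _ ≤ ∫ t in Ioi (0 : ℝ), (d.factorial / (‖x‖ ^ 2 / 4) ^ d) *
          (Real.exp (-t) * t ^ ((d : ℝ) - (d - a) / 2 - 1)) := by
        refine integral_mono_of_nonneg ?_ ((Real.GammaIntegral_convergent hq).const_mul _) ?_
        · filter_upwards [ae_restrict_mem measurableSet_Ioi] with t (ht : 0 < t)
          simp only [Pi.zero_apply]
          positivity
        · filter_upwards [ae_restrict_mem measurableSet_Ioi] with t (ht : 0 < t)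
          have h1 : Real.exp (-(‖x‖ ^ 2 / 4) / t) ≤ d.factorial / (‖x‖ ^ 2 / 4) ^ d * t ^ d := by
            have := Real.pow_div_factorial_le_exp (x := ‖x‖ ^ 2 / 4 / t) (by positivity) d
            rw [neg_div, Real.exp_neg]
            refine (inv_anti₀ (by positivity) this).trans_eq ?_
            rw [div_pow, inv_div]
            field_simp
          calc _ ≤ t ^ (-(((d : ℝ) - a) / 2) - 1) * (d.factorial / (‖x‖ ^ 2 / 4) ^ d * t ^ d) *
                Real.exp (-t) := by gcongr
            _ = _ := by
              rw [show (d : ℝ) - (d - a) / 2 - 1 = (-(((d : ℝ) - a) / 2) - 1) + d by ring,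
                Real.rpow_add_natCast ht.ne']
              ring
    _ = _ := by
        rw [integral_const_mul, ← Real.Gamma_eq_integral hq, Real.rpow_neg hx'.le,
          Real.rpow_mul hx'.le, Real.rpow_natCast, Real.rpow_two, div_pow]
        field_simp

lemma le_besselKer {d : ℕ} {a : ℝ} (had : a < d) :
    ∃ c : ℝ, 0 < c ∧ ∀ x : EuclideanSpace ℝ (Fin d), x ≠ 0 → ‖x‖ ≤ 4 →
      c * ‖x‖ ^ (-((d : ℝ) - a)) ≤ besselKer d a x := by
  have hp : 0 < ((d : ℝ) - a) / 2 := by linarith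
  refine ⟨(4 * Real.pi) ^ (-(d : ℝ) / 2) * ((2 : ℝ) ^ (-(((d : ℝ) - a) / 2) - 1) *
    Real.exp (-(1 / 4)) * Real.exp (-32)), by positivity, fun x hx hx4 => ?_⟩
  have hx' : 0 < ‖x‖ := norm_pos_iff.2 hx
  have hb : 0 < ‖x‖ ^ 2 / 4 := by positivity
  have hsq : 0 < ‖x‖ ^ 2 := by positivity
  rw [besselKer_eq, mul_assoc]
  gcongr
  have hint : IntegrableOn (fun t : ℝ => t ^ (-(((d : ℝ) - a) / 2) - 1) *
      Real.exp (-(‖x‖ ^ 2 / 4) / t) * Real.exp (-t)) (Ioi 0) := by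
    refine (integrableOn_rpow_mul_exp_neg_div hp hb).mono' ?_ ?_
    · exact Measurable.aestronglyMeasurable (by fun_prop)
    · filter_upwards [ae_restrict_mem measurableSet_Ioi] with t (ht : 0 < t)
      rw [Real.norm_of_nonneg (by positivity)]
      exact mul_le_of_le_one_right (by positivity) (by simpa using ht.le)
  have hsub : Ioc (‖x‖ ^ 2) (2 * ‖x‖ ^ 2) ⊆ Ioi (0 : ℝ) := fun t ht => hsq.trans ht.1
  calc _ = ∫ t in Ioc (‖x‖ ^ 2) (2 * ‖x‖ ^ 2), (2 * ‖x‖ ^ 2) ^ (-(((d : ℝ) - a) / 2) - 1) *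
        Real.exp (-(1 / 4)) * Real.exp (-32) := by
        rw [setIntegral_const, Real.volume_real_Ioc_of_le (by linarith), smul_eq_mul,
          Real.mul_rpow (by norm_num) (by positivity)]
        have : ‖x‖ ^ (-((d : ℝ) - a)) =
            (‖x‖ ^ 2) ^ (-(((d : ℝ) - a) / 2) - 1) * ‖x‖ ^ 2 := by
          rw [← Real.rpow_add_one hsq.ne', ← Real.rpow_natCast, ← Real.rpow_mul hx'.le]
          congr 1
          push_cast
          ring
        rw [this]
        ring
    _ ≤ ∫ t in Ioc (‖x‖ ^ 2) (2 * ‖x‖ ^ 2), t ^ (-(((d : ℝ) - a) / 2) - 1) *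
        Real.exp (-(‖x‖ ^ 2 / 4) / t) * Real.exp (-t) := by
        refine setIntegral_mono_on (integrableOn_const (by simp)) (hint.mono_set hsub)
          measurableSet_Ioc fun t ht => ?_
        have ht0 : 0 < t := hsub ht
        have h1 : (2 * ‖x‖ ^ 2) ^ (-(((d : ℝ) - a) / 2) - 1) ≤ t ^ (-(((d : ℝ) - a) / 2) - 1) :=
          Real.rpow_le_rpow_of_nonpos ht0 ht.2 (by linarith)
        have h2 : -(1 / 4 : ℝ) ≤ -(‖x‖ ^ 2 / 4) / t := by
          rw [neg_div, neg_le_neg_iff, div_le_iff₀ ht0]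
          linarith [ht.1]
        have h3 : (-32 : ℝ) ≤ -t := by nlinarith [ht.2]
        gcongr
    _ ≤ _ := by
        refine setIntegral_mono_set hint ?_ hsub.eventuallyLE
        filter_upwards [ae_restrict_mem measurableSet_Ioi] with t (ht : 0 < t)
        simp only [Pi.zero_apply]
        positivity

lemma setLIntegral_norm_rpow {d : ℕ} (hd : 1 ≤ d) :
    ∃ κ : ℝ, 0 < κ ∧ ∀ (S : Set ℝ) (e : ℝ), MeasurableSet S → S ⊆ Ioi 0 →
      IntegrableOn (fun u : ℝ => u ^ ((d : ℝ) - 1 + e)) S →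
      ∫⁻ y in {y : EuclideanSpace ℝ (Fin d) | ‖y‖ ∈ S}, ENNReal.ofReal (‖y‖ ^ e) =
        ENNReal.ofReal (κ * ∫ u in S, u ^ ((d : ℝ) - 1 + e)) := by
  have : Nonempty (Fin d) := ⟨⟨0, hd⟩⟩
  refine ⟨d * volume.real (Metric.ball (0 : EuclideanSpace ℝ (Fin d)) 1), ?_,
    fun S e hS hS0 hint => ?_⟩
  · have : 0 < volume.real (Metric.ball (0 : EuclideanSpace ℝ (Fin d)) 1) :=
      ENNReal.toReal_pos (Metric.measure_ball_pos _ _ one_pos).ne' measure_ball_lt_top.ne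
    positivity
  have hpow : ∀ u ∈ Ioi (0 : ℝ), u ^ (d - 1) • S.indicator (fun u => u ^ e) u =
      S.indicator (fun u : ℝ => u ^ ((d : ℝ) - 1 + e)) u := by
    intro u (hu : 0 < u)
    by_cases h : u ∈ S
    · simp only [indicator_of_mem h, smul_eq_mul]
      rw [← Real.rpow_natCast, ← Real.rpow_add hu, Nat.cast_sub hd, Nat.cast_one]
    · simp [h]
  have hmeas : MeasurableSet {y : EuclideanSpace ℝ (Fin d) | ‖y‖ ∈ S} := measurable_norm hS
  have hI : Integrable (fun y : EuclideanSpace ℝ (Fin d) =>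
      S.indicator (fun u : ℝ => u ^ e) ‖y‖) := by
    rw [integrable_fun_norm_addHaar volume (f := S.indicator (fun u : ℝ => u ^ e)),
      finrank_euclideanSpace_fin, integrableOn_congr_fun hpow measurableSet_Ioi,
      IntegrableOn, integrable_indicator_iff hS, IntegrableOn, Measure.restrict_restrict hS,
      inter_eq_left.2 hS0]
    exact hint
  have hval := integral_fun_norm_addHaar (volume : Measure (EuclideanSpace ℝ (Fin d)))
    (S.indicator (fun u : ℝ => u ^ e))
  rw [finrank_euclideanSpace_fin, setIntegral_congr_fun measurableSet_Ioi hpow,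
    setIntegral_indicator hS, inter_eq_right.2 hS0, nsmul_eq_mul, smul_eq_mul, ← mul_assoc] at hval
  rw [← hval, ofReal_integral_eq_lintegral_ofReal hI, ← lintegral_indicator hmeas]
  · refine lintegral_congr fun y => ?_
    by_cases h : ‖y‖ ∈ S <;> simp [indicator, h]
  · refine ae_of_all _ fun y => ?_
    exact indicator_nonneg (fun u hu => Real.rpow_nonneg (hS0 hu).le _) _

/-- A radial majorant of `y ↦ ‖x - y‖ ^ (-s) * ‖y‖ ^ (-s)` on the half space `‖y‖ ≤ ‖x - y‖`,
where `σ = ‖x‖ / 2`, with fast decay at infinity. -/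
noncomputable def radialMajorant (d : ℕ) (s σ : ℝ) (y : EuclideanSpace ℝ (Fin d)) : ℝ≥0∞ :=
  {y : EuclideanSpace ℝ (Fin d) | ‖y‖ ∈ Ioc 0 σ}.indicator
      (fun y => ENNReal.ofReal (σ ^ (-s)) * ENNReal.ofReal (‖y‖ ^ (-s))) y +
    {y : EuclideanSpace ℝ (Fin d) | ‖y‖ ∈ Ioc σ 1}.indicator
      (fun y => ENNReal.ofReal (‖y‖ ^ (-(2 * s)))) y +
    {y : EuclideanSpace ℝ (Fin d) | ‖y‖ ∈ Ioi 1}.indicator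
      (fun y => ENNReal.ofReal (‖y‖ ^ (-(2 * (d : ℝ))))) y

lemma measurable_radialMajorant (d : ℕ) (s σ : ℝ) : Measurable (radialMajorant d s σ) := by
  unfold radialMajorant
  refine ((Measurable.indicator ?_ (measurable_norm measurableSet_Ioc)).add
    (Measurable.indicator ?_ (measurable_norm measurableSet_Ioc))).add
    (Measurable.indicator ?_ (measurable_norm measurableSet_Ioi)) <;> fun_prop

lemma ofReal_mul_le_radialMajorant {d : ℕ} {s σ C : ℝ} (hs : 0 < s) (hσ : 0 < σ) (hσ1 : σ < 1)
    (hC : 0 < C) {F : EuclideanSpace ℝ (Fin d) → ℝ} (hF0 : ∀ y, 0 ≤ F y)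
    (hF1 : ∀ y, y ≠ 0 → F y ≤ C * ‖y‖ ^ (-s))
    (hF2 : ∀ y, y ≠ 0 → 1 ≤ ‖y‖ → F y ≤ C * ‖y‖ ^ (-(2 * (d : ℝ))))
    {y z : EuclideanSpace ℝ (Fin d)} (hy : y ≠ 0) (hyz : ‖y‖ ≤ ‖z‖) (hσz : σ ≤ ‖z‖) :
    ENNReal.ofReal (F z * F y) ≤ ENNReal.ofReal (C ^ 2) * radialMajorant d s σ y := by
  have hy' : 0 < ‖y‖ := norm_pos_iff.2 hy
  have hz' : 0 < ‖z‖ := hσ.trans_le hσz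
  have hz : z ≠ 0 := norm_pos_iff.1 hz'
  rcases le_or_gt ‖y‖ σ with h1 | h1
  · have : F z * F y ≤ C ^ 2 * (σ ^ (-s) * ‖y‖ ^ (-s)) := by
      have h2 : F z ≤ C * σ ^ (-s) := (hF1 z hz).trans
        (mul_le_mul_of_nonneg_left
          (Real.rpow_le_rpow_of_nonpos hσ hσz (neg_nonpos.2 hs.le)) hC.le)
      calc _ ≤ (C * σ ^ (-s)) * (C * ‖y‖ ^ (-s)) :=
            mul_le_mul h2 (hF1 y hy) (hF0 y) (by positivity)
        _ = _ := by ring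
    refine (ENNReal.ofReal_le_ofReal this).trans ?_
    rw [ENNReal.ofReal_mul (by positivity), ENNReal.ofReal_mul (by positivity)]
    gcongr
    simp [radialMajorant, indicator, hy, h1, h1.not_gt, (h1.trans hσ1.le).not_gt]
  rcases le_or_gt ‖y‖ 1 with h2 | h2
  · have : F z * F y ≤ C ^ 2 * ‖y‖ ^ (-(2 * s)) := by
      have h3 : F z ≤ C * ‖y‖ ^ (-s) := (hF1 z hz).trans
        (mul_le_mul_of_nonneg_left
          (Real.rpow_le_rpow_of_nonpos hy' hyz (neg_nonpos.2 hs.le)) hC.le)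
      calc _ ≤ (C * ‖y‖ ^ (-s)) * (C * ‖y‖ ^ (-s)) :=
            mul_le_mul h3 (hF1 y hy) (hF0 y) (by positivity)
        _ = _ := by
          rw [show -(2 * s) = -s + -s by ring, Real.rpow_add hy']
          ring
    refine (ENNReal.ofReal_le_ofReal this).trans ?_
    rw [ENNReal.ofReal_mul (by positivity)]
    gcongr
    simp [radialMajorant, indicator, h1, h2, h1.not_ge, h2.not_gt]
  · have : F z * F y ≤ C ^ 2 * ‖y‖ ^ (-(2 * (d : ℝ))) := by
      have h3 : F z ≤ C := (hF1 z hz).trans <| mul_le_of_le_one_right hC.le <|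
        Real.rpow_le_one_of_one_le_of_nonpos (h2.le.trans hyz) (by linarith)
      calc _ ≤ C * (C * ‖y‖ ^ (-(2 * (d : ℝ)))) :=
            mul_le_mul h3 (hF2 y hy h2.le) (hF0 y) hC.le
        _ = _ := by ring
    refine (ENNReal.ofReal_le_ofReal this).trans ?_
    rw [ENNReal.ofReal_mul (by positivity)]
    gcongr
    simp [radialMajorant, indicator, h1.not_ge, h2, h2.not_ge]

lemma integrableOn_Ioc_rpow {p q e : ℝ} (hp : 0 < p) :
    IntegrableOn (fun u : ℝ => u ^ e) (Ioc p q) := by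
  refine (ContinuousOn.integrableOn_Icc fun u hu => ?_).mono_set Ioc_subset_Icc_self
  exact (Real.continuousAt_rpow_const _ _ (Or.inl (hp.trans_le hu.1).ne')).continuousWithinAt

lemma setIntegral_Ioc_rpow_nonneg {p q e : ℝ} (hp : 0 < p) :
    0 ≤ ∫ u in Ioc p q, u ^ e :=
  setIntegral_nonneg measurableSet_Ioc fun _ hu => Real.rpow_nonneg (hp.trans hu.1).le _

lemma lintegral_radialMajorant_le {d : ℕ} (hd : 1 ≤ d) {s : ℝ} (hsd : s < d) :
    ∃ C : ℝ, 0 < C ∧ ∀ ρ : ℝ, 0 < ρ → ρ < 1 →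
      ∫⁻ y, radialMajorant d s (ρ / 2) y ≤ ENNReal.ofReal (C * (ρ ^ ((d : ℝ) - 2 * s) +
        (∫ u in Ioc (ρ / 2) 1, u ^ ((d : ℝ) - 1 + -(2 * s))) + 1)) := by
  obtain ⟨κ, hκ, hrad⟩ := setLIntegral_norm_rpow hd
  have hd' : (1 : ℝ) ≤ d := by exact_mod_cast hd
  have hds : 0 < (d : ℝ) - s := by linarith
  set M : ℝ := (1 / 2) ^ ((d : ℝ) - 2 * s) / (d - s)
  have hM : 0 < M := by positivity
  refine ⟨κ * (M + 1), by positivity, fun ρ hρ hρ1 => ?_⟩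
  have hσ : 0 < ρ / 2 := by positivity
  have hint1 : IntegrableOn (fun u : ℝ => u ^ ((d : ℝ) - 1 + -s)) (Ioc 0 (ρ / 2)) :=
    (intervalIntegrable_iff_integrableOn_Ioc_of_le hσ.le).1
      (intervalIntegral.intervalIntegrable_rpow' (by linarith))
  have hA : ∫ u in Ioc 0 (ρ / 2), u ^ ((d : ℝ) - 1 + -s) = (ρ / 2) ^ ((d : ℝ) - s) / (d - s) := by
    rw [← intervalIntegral.integral_of_le hσ.le, integral_rpow (Or.inl (by linarith)),
      show (d : ℝ) - 1 + -s + 1 = d - s by ring, Real.zero_rpow hds.ne', sub_zero]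
  have hD : ∫ u in Ioi (1 : ℝ), u ^ ((d : ℝ) - 1 + -(2 * (d : ℝ))) = 1 / d := by
    rw [integral_Ioi_rpow_of_lt (by linarith) one_pos, Real.one_rpow,
      show (d : ℝ) - 1 + -(2 * (d : ℝ)) + 1 = -d by ring, neg_div_neg_eq]
  have hJ := setIntegral_Ioc_rpow_nonneg (q := 1) (e := (d : ℝ) - 1 + -(2 * s)) hσ
  unfold radialMajorant
  have hmeas {S : Set ℝ} (hS : MeasurableSet S) :
      MeasurableSet {y : EuclideanSpace ℝ (Fin d) | ‖y‖ ∈ S} := measurable_norm hS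
  rw [lintegral_add_right _ (Measurable.indicator (by fun_prop) (hmeas measurableSet_Ioi)),
    lintegral_add_right _ (Measurable.indicator (by fun_prop) (hmeas measurableSet_Ioc)),
    lintegral_indicator (hmeas measurableSet_Ioc), lintegral_indicator (hmeas measurableSet_Ioc),
    lintegral_indicator (hmeas measurableSet_Ioi), lintegral_const_mul _ (by fun_prop),
    hrad _ _ measurableSet_Ioc (fun u hu => hu.1) hint1,
    hrad _ _ measurableSet_Ioc (fun u hu => hσ.trans hu.1) (integrableOn_Ioc_rpow hσ),
    hrad _ _ measurableSet_Ioi (fun u (hu : 1 < u) => one_pos.trans hu)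
      (integrableOn_Ioi_rpow_of_lt (by linarith) one_pos)]
  rw [hA, hD, ← ENNReal.ofReal_mul (by positivity),
    ← ENNReal.ofReal_add (by positivity) (by positivity),
    ← ENNReal.ofReal_add (by positivity) (by positivity)]
  refine ENNReal.ofReal_le_ofReal ?_
  have hsplit : (ρ / 2) ^ (-s) * (κ * ((ρ / 2) ^ ((d : ℝ) - s) / (d - s))) =
      κ * (M * ρ ^ ((d : ℝ) - 2 * s)) := by
    have : (ρ / 2) ^ (-s) * (ρ / 2) ^ ((d : ℝ) - s) =
        (1 / 2) ^ ((d : ℝ) - 2 * s) * ρ ^ ((d : ℝ) - 2 * s) := by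
      rw [← Real.rpow_add hσ, ← Real.mul_rpow (by norm_num) hρ.le]
      congr 1 <;> ring
    calc _ = κ * ((ρ / 2) ^ (-s) * (ρ / 2) ^ ((d : ℝ) - s)) / (d - s) := by ring
      _ = _ := by rw [this]; simp only [M]; ring
  rw [hsplit, mul_assoc, ← mul_add, ← mul_add]
  have h1 : 1 / (d : ℝ) ≤ 1 := by rw [div_le_one (by linarith)]; exact hd'
  have h2 : 0 < ρ ^ ((d : ℝ) - 2 * s) := by positivity
  have h3 := mul_nonneg hM.le hJ
  gcongr
  linarith

lemma lintegral_mul_le_of_le_rpow {d : ℕ} (hd : 1 ≤ d) {s C : ℝ} (hs : 0 < s) (hsd : s < d)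
    (hC : 0 < C) {F : EuclideanSpace ℝ (Fin d) → ℝ} (hF0 : ∀ y, 0 ≤ F y)
    (hF1 : ∀ y, y ≠ 0 → F y ≤ C * ‖y‖ ^ (-s))
    (hF2 : ∀ y, y ≠ 0 → 1 ≤ ‖y‖ → F y ≤ C * ‖y‖ ^ (-(2 * (d : ℝ)))) :
    ∃ B : ℝ, 0 < B ∧ ∀ x : EuclideanSpace ℝ (Fin d), x ≠ 0 → ‖x‖ < 1 →
      ∫⁻ y, ENNReal.ofReal (F (x - y) * F y) ≤
        ENNReal.ofReal (B * (‖x‖ ^ ((d : ℝ) - 2 * s) +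
          (∫ u in Ioc (‖x‖ / 2) 1, u ^ ((d : ℝ) - 1 + -(2 * s))) + 1)) := by
  obtain ⟨A, hA, hmaj⟩ := lintegral_radialMajorant_le hd hsd
  have : Nonempty (Fin d) := ⟨⟨0, hd⟩⟩
  refine ⟨C ^ 2 * (A + A), by positivity, fun x hx hx1 => ?_⟩
  have hx' : 0 < ‖x‖ := norm_pos_iff.2 hx
  have hpt : ∀ᵐ y : EuclideanSpace ℝ (Fin d), ENNReal.ofReal (F (x - y) * F y) ≤
      ENNReal.ofReal (C ^ 2) *
        (radialMajorant d s (‖x‖ / 2) y + radialMajorant d s (‖x‖ / 2) (x - y)) := by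
    filter_upwards [Measure.ae_ne volume (0 : EuclideanSpace ℝ (Fin d)),
      Measure.ae_ne volume x] with y hy hyx
    have hz : x - y ≠ 0 := sub_ne_zero.2 hyx.symm
    have htri : ‖x‖ ≤ ‖x - y‖ + ‖y‖ := by simpa using norm_add_le (x - y) y
    rcases le_total ‖y‖ ‖x - y‖ with h | h
    · refine (ofReal_mul_le_radialMajorant hs (σ := ‖x‖ / 2) (by linarith) (by linarith) hC hF0
        hF1 hF2 hy h (by linarith)).trans ?_
      gcongr
      exact le_self_add
    · rw [mul_comm]
      refine (ofReal_mul_le_radialMajorant hs (σ := ‖x‖ / 2) (by linarith) (by linarith) hC hF0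
        hF1 hF2 hz h (by linarith)).trans ?_
      gcongr
      exact le_add_self
  have hJ := setIntegral_Ioc_rpow_nonneg (q := 1) (e := (d : ℝ) - 1 + -(2 * s)) (half_pos hx')
  calc _ ≤ _ := lintegral_mono_ae hpt
    _ = ENNReal.ofReal (C ^ 2) * ((∫⁻ y, radialMajorant d s (‖x‖ / 2) y) +
          ∫⁻ y, radialMajorant d s (‖x‖ / 2) y) := by
        rw [lintegral_const_mul' _ _ ENNReal.ofReal_ne_top,
          lintegral_add_left (measurable_radialMajorant d s _),
          lintegral_sub_left_eq_self (radialMajorant d s (‖x‖ / 2)) x]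
    _ ≤ _ := by
        grw [hmaj _ hx' hx1]
        rw [← ENNReal.ofReal_add (by positivity) (by positivity),
          ← ENNReal.ofReal_mul (by positivity), ← add_mul, ← mul_assoc]

lemma le_lintegral_mul_of_rpow_le {d : ℕ} (hd : 1 ≤ d) {s c : ℝ} (hs : 0 < s) (hc : 0 < c)
    {F : EuclideanSpace ℝ (Fin d) → ℝ}
    (hF : ∀ y, y ≠ 0 → ‖y‖ ≤ 4 → c * ‖y‖ ^ (-s) ≤ F y) :
    ∃ b : ℝ, 0 < b ∧ ∀ x : EuclideanSpace ℝ (Fin d), x ≠ 0 →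
      ENNReal.ofReal (b * ∫ u in Ioc ‖x‖ 2, u ^ ((d : ℝ) - 1 + -(2 * s))) ≤
        ∫⁻ y, ENNReal.ofReal (F (x - y) * F y) := by
  obtain ⟨κ, hκ, hrad⟩ := setLIntegral_norm_rpow hd
  have : Nonempty (Fin d) := ⟨⟨0, hd⟩⟩
  refine ⟨c ^ 2 * 2 ^ (-s) * κ, by positivity, fun x hx => ?_⟩
  have hx' : 0 < ‖x‖ := norm_pos_iff.2 hx
  have hmeas : MeasurableSet {y : EuclideanSpace ℝ (Fin d) | ‖y‖ ∈ Ioc ‖x‖ 2} :=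
    measurable_norm measurableSet_Ioc
  rw [mul_assoc, ENNReal.ofReal_mul (by positivity),
    ← hrad _ _ measurableSet_Ioc (fun u hu => hx'.trans hu.1) (integrableOn_Ioc_rpow hx'),
    ← lintegral_const_mul' _ _ ENNReal.ofReal_ne_top]
  refine le_trans (lintegral_mono_ae ?_) (setLIntegral_le_lintegral _ _)
  filter_upwards [ae_restrict_mem hmeas, ae_restrict_of_ae (Measure.ae_ne volume x)]
    with y ⟨hy1, hy2⟩ hyx
  have hy' : 0 < ‖y‖ := hx'.trans hy1
  have hz : x - y ≠ 0 := sub_ne_zero.2 hyx.symm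
  have hz' : 0 < ‖x - y‖ := norm_pos_iff.2 hz
  have htri : ‖x - y‖ ≤ 2 * ‖y‖ := (norm_sub_le x y).trans (by linarith)
  rw [← ENNReal.ofReal_mul (by positivity)]
  refine ENNReal.ofReal_le_ofReal ?_
  have h1 : c * (2 * ‖y‖) ^ (-s) ≤ F (x - y) := 
    (mul_le_mul_of_nonneg_left (Real.rpow_le_rpow_of_nonpos hz' htri (neg_nonpos.2 hs.le))
      hc.le).trans (hF _ hz (by linarith))
  have h2 := hF y (norm_pos_iff.1 hy') (by linarith)
  calc _ = c * (2 * ‖y‖) ^ (-s) * (c * ‖y‖ ^ (-s)) := by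
        rw [Real.mul_rpow (by norm_num) hy'.le, show -(2 * s) = -s + -s by ring,
          Real.rpow_add hy']
        ring
    _ ≤ _ := mul_le_mul h1 h2 (by positivity) (le_trans (by positivity) h1)

lemma besselKer_rpow_le {d : ℕ} (hd : 1 ≤ d) {a r : ℝ} (ha0 : 0 < a) (had : a < d) (hr : 1 ≤ r) :
    ∃ C : ℝ, 0 < C ∧
      (∀ y : EuclideanSpace ℝ (Fin d), y ≠ 0 →
        besselKer d a y ^ r ≤ C * ‖y‖ ^ (-(r * ((d : ℝ) - a)))) ∧
      ∀ y : EuclideanSpace ℝ (Fin d), y ≠ 0 → 1 ≤ ‖y‖ →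
        besselKer d a y ^ r ≤ C * ‖y‖ ^ (-(2 * (d : ℝ))) := by
  obtain ⟨C₁, hC₁, h₁⟩ := besselKer_le_rpow (d := d) had
  obtain ⟨C₂, hC₂, h₂⟩ := besselKer_le_rpow_neg_two_mul hd ha0
  have hr0 : 0 ≤ r := by linarith
  refine ⟨C₁ ^ r + C₂ ^ r, by positivity, fun y hy => ?_, fun y hy hy1 => ?_⟩
  · refine (Real.rpow_le_rpow (besselKer_nonneg d a y) (h₁ y hy) hr0).trans ?_
    rw [Real.mul_rpow hC₁.le (by positivity), ← Real.rpow_mul (norm_nonneg y),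
      show -((d : ℝ) - a) * r = -(r * (d - a)) by ring]
    gcongr
    exact le_add_of_nonneg_right (by positivity)
  · refine (Real.rpow_le_rpow (besselKer_nonneg d a y) (h₂ y hy) hr0).trans ?_
    rw [Real.mul_rpow hC₂.le (by positivity), ← Real.rpow_mul (norm_nonneg y)]
    have hd0 : (0 : ℝ) ≤ d := d.cast_nonneg
    refine mul_le_mul (le_add_of_nonneg_left (by positivity))
      (Real.rpow_le_rpow_of_exponent_le hy1 ?_) (by positivity) (by positivity)
    nlinarith

lemma le_besselKer_rpow {d : ℕ} {a r : ℝ} (had : a < d) (hr : 1 ≤ r) :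
    ∃ c : ℝ, 0 < c ∧ ∀ y : EuclideanSpace ℝ (Fin d), y ≠ 0 → ‖y‖ ≤ 4 →
      c * ‖y‖ ^ (-(r * ((d : ℝ) - a))) ≤ besselKer d a y ^ r := by
  obtain ⟨c, hc, h⟩ := le_besselKer (d := d) had
  refine ⟨c ^ r, by positivity, fun y hy hy4 => ?_⟩
  refine Eq.trans_le ?_ (Real.rpow_le_rpow (by positivity) (h y hy hy4) (by linarith))
  rw [Real.mul_rpow hc.le (by positivity), ← Real.rpow_mul (norm_nonneg y),
    show -((d : ℝ) - a) * r = -(r * (d - a)) by ring]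

lemma setIntegral_Ioc_rpow {p q e : ℝ} (hp : 0 < p) (hpq : p ≤ q) (he : e ≠ -1) :
    ∫ u in Ioc p q, u ^ e = (q ^ (e + 1) - p ^ (e + 1)) / (e + 1) := by
  rw [← intervalIntegral.integral_of_le hpq, integral_rpow (Or.inr ⟨he, ?_⟩)]
  exact notMem_uIcc_of_lt hp (hp.trans_le hpq)

lemma setIntegral_Ioc_rpow_neg_one {p q : ℝ} (hp : 0 < p) (hpq : p ≤ q) :
    ∫ u in Ioc p q, u ^ (-1 : ℝ) = Real.log (q / p) := by
  simp_rw [Real.rpow_neg_one]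
  rw [← intervalIntegral.integral_of_le hpq, integral_inv_of_pos hp (hp.trans_le hpq)]

/-- **Local two-sided bounds for convolutions of powers of Bessel kernels.**
Here `α := d - r(d - a)`. -/
theorem besselConv_local_two_sided_bounds (d : ℕ) (hd : 1 ≤ d) (a : ℝ)
    (ha0 : 0 < a) (had : a < d) (r : ℝ) (hr : 1 ≤ r) (hr' : r < (d : ℝ) / ((d : ℝ) - a)) :
    ∃ c C : ℝ, 0 < c ∧ c ≤ C ∧
      ∀ x : EuclideanSpace ℝ (Fin d), x ≠ 0 → ‖x‖ < 1 →
        (((d : ℝ) / 2 < (d : ℝ) - r * ((d : ℝ) - a) →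
            ENNReal.ofReal c ≤ besselConv d a r x ∧ besselConv d a r x ≤ ENNReal.ofReal C) ∧
         ((d : ℝ) - r * ((d : ℝ) - a) < (d : ℝ) / 2 →
            ENNReal.ofReal (c * ‖x‖ ^ (2 * ((d : ℝ) - r * ((d : ℝ) - a)) - d)) ≤
                besselConv d a r x ∧
              besselConv d a r x ≤
                ENNReal.ofReal (C * ‖x‖ ^ (2 * ((d : ℝ) - r * ((d : ℝ) - a)) - d))) ∧
         ((d : ℝ) - r * ((d : ℝ) - a) = (d : ℝ) / 2 →
            ENNReal.ofReal (c * Real.log (1 / ‖x‖)) ≤ besselConv d a r x ∧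
              besselConv d a r x ≤ ENNReal.ofReal (C * (1 + Real.log (1 / ‖x‖))))) := by
  have hda : 0 < (d : ℝ) - a := by linarith
  obtain ⟨C, hC, hF1, hF2⟩ := besselKer_rpow_le hd ha0 had hr
  obtain ⟨c, hc, hF⟩ := le_besselKer_rpow (d := d) had hr
  rw [lt_div_iff₀ hda] at hr'
  have hs : 0 < r * ((d : ℝ) - a) := by positivity
  obtain ⟨B, hB, hup⟩ := lintegral_mul_le_of_le_rpow hd hs hr' hC
    (fun y => Real.rpow_nonneg (besselKer_nonneg d a y) r) hF1 hF2
  obtain ⟨b, hb, hlow⟩ := le_lintegral_mul_of_rpow_le hd hs hc hF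
  change ∀ x : EuclideanSpace ℝ (Fin d), x ≠ 0 → ‖x‖ < 1 → besselConv d a r x ≤ _ at hup
  change ∀ x : EuclideanSpace ℝ (Fin d), x ≠ 0 → _ ≤ besselConv d a r x at hlow
  set s : ℝ := r * ((d : ℝ) - a)
  rcases lt_trichotomy ((d : ℝ) - s) (d / 2) with h | h | h
  · have hE : (d : ℝ) - 2 * s < 0 := by linarith
    have he : (d : ℝ) - 1 + -(2 * s) ≠ -1 := by linarith
    have he1 : (d : ℝ) - 1 + -(2 * s) + 1 = d - 2 * s := by ring
    have h2E : (2 : ℝ) ^ ((d : ℝ) - 2 * s) < 1 :=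
      Real.rpow_lt_one_of_one_lt_of_neg one_lt_two hE
    rw [show 2 * ((d : ℝ) - s) - d = d - 2 * s by ring]
    set E : ℝ := (d : ℝ) - 2 * s
    have hc0 : 0 < (1 - 2 ^ E) / -E := div_pos (by linarith) (by linarith)
    refine ⟨b * ((1 - 2 ^ E) / -E), _, by positivity, le_max_left _ (B * (2 + (1 / 2) ^ E / -E)),
      fun x hx hx1 => ⟨fun h' => by linarith, fun _ => ⟨?_, ?_⟩, fun h' => by linarith⟩⟩ <;>
      have hx' : 0 < ‖x‖ := norm_pos_iff.2 hx <;>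
      have hxE : 1 ≤ ‖x‖ ^ E := Real.one_le_rpow_of_pos_of_le_one_of_nonpos hx' hx1.le hE.le
    · refine le_trans (ENNReal.ofReal_le_ofReal ?_) (hlow x hx)
      rw [setIntegral_Ioc_rpow hx' (by linarith) he, he1, mul_assoc]
      gcongr
      rw [← neg_div_neg_eq (2 ^ E - ‖x‖ ^ E), div_mul_eq_mul_div]
      refine div_le_div_of_nonneg_right ?_ (by linarith)
      have : 0 < (2 : ℝ) ^ E := by positivity
      nlinarith
    · refine (hup x hx hx1).trans (ENNReal.ofReal_le_ofReal ?_)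
      refine le_trans ?_ (mul_le_mul_of_nonneg_right (le_max_right _ _) (by positivity))
      rw [setIntegral_Ioc_rpow (by positivity) (by linarith) he, he1, Real.one_rpow, mul_assoc,
        ← neg_div_neg_eq (1 - _)]
      gcongr
      have : -(1 - (‖x‖ / 2) ^ E) / -E ≤ (1 / 2) ^ E / -E * ‖x‖ ^ E := by
        rw [div_mul_eq_mul_div]
        refine div_le_div_of_nonneg_right ?_ (by linarith)
        rw [← Real.mul_rpow (by norm_num) hx'.le, one_div_mul_eq_div]
        linarith
      linarith
  · have hE : (d : ℝ) - 2 * s = 0 := by linarith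
    have he : (d : ℝ) - 1 + -(2 * s) = -1 := by linarith
    rw [he] at hlow hup
    rw [hE] at hup
    refine ⟨b, _, hb, le_max_left _ (B * 3),
      fun x hx hx1 => ⟨fun h' => by linarith, fun h' => by linarith, fun _ => ⟨?_, ?_⟩⟩⟩ <;>
      have hx' : 0 < ‖x‖ := norm_pos_iff.2 hx
    · refine le_trans (ENNReal.ofReal_le_ofReal ?_) (hlow x hx)
      rw [setIntegral_Ioc_rpow_neg_one hx' (by linarith)]
      gcongr
      norm_num
    · refine (hup x hx hx1).trans (ENNReal.ofReal_le_ofReal ?_)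
      have hlog : 0 < Real.log (1 / ‖x‖) := Real.log_pos (by rwa [lt_div_iff₀ hx', one_mul])
      refine le_trans ?_ (mul_le_mul_of_nonneg_right (le_max_right _ _) (by positivity))
      rw [setIntegral_Ioc_rpow_neg_one (by positivity) (by linarith), Real.rpow_zero, mul_assoc,
        show 1 / (‖x‖ / 2) = 2 * (1 / ‖x‖) by field_simp,
        Real.log_mul two_ne_zero (by positivity)]
      gcongr
      linarith [Real.log_two_lt_d9]
  · have hE : 0 < (d : ℝ) - 2 * s := by linarith
    have he : (d : ℝ) - 1 + -(2 * s) ≠ -1 := by linarith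
    have he1 : (d : ℝ) - 1 + -(2 * s) + 1 = d - 2 * s := by ring
    have h2E : 1 < (2 : ℝ) ^ ((d : ℝ) - 2 * s) := Real.one_lt_rpow one_lt_two hE
    set E : ℝ := (d : ℝ) - 2 * s
    have hc0 : 0 < (2 ^ E - 1) / E := div_pos (by linarith) hE
    refine ⟨b * ((2 ^ E - 1) / E), _, by positivity, le_max_left _ (B * (2 + 1 / E)),
      fun x hx hx1 => ⟨fun _ => ⟨?_, ?_⟩, fun h' => by linarith, fun h' => by linarith⟩⟩ <;>
      have hx' : 0 < ‖x‖ := norm_pos_iff.2 hx <;>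
      have hxE : ‖x‖ ^ E ≤ 1 := Real.rpow_le_one hx'.le hx1.le hE.le
    · refine le_trans (ENNReal.ofReal_le_ofReal ?_) (hlow x hx)
      rw [setIntegral_Ioc_rpow hx' (by linarith) he, he1]
      gcongr
    · refine (hup x hx hx1).trans (ENNReal.ofReal_le_ofReal ?_)
      refine le_trans ?_ (le_max_right _ _)
      rw [setIntegral_Ioc_rpow (by positivity) (by linarith) he, he1, Real.one_rpow]
      refine mul_le_mul_of_nonneg_left ?_ hB.le
      have : (1 - (‖x‖ / 2) ^ E) / E ≤ 1 / E := by
        gcongr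
        exact sub_le_self _ (by positivity)
      linarith
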